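/- arXiv:1503.03304 — 2 statements merged into one kernel-verified Lean document; each statement's English description precedes it below -/
import Mathlib

section
/- Let d ≥ 2, let k ∈ ℤ^d be nonzero and m ∈ ℤ be nonzero, and let Γ = {γ ∈ ℝ^d : γ·k = m} be the corresponding affine hyperplane. If A ⊆ Γ has full measure in Γ (with respect to the (d−1)-dimensional Hausdorff measure on Γ, equivalently the surface measure of the hyperplane), then the cone {t·γ : t ∈ ℝ, t ≠ 0, γ ∈ A} generated by A has full Lebesgue measure in ℝ^d. -/
open MeasureTheory
open scoped BigOperators

/-- A set of functions whose restrictions to the coordinates other than `i` lie in a null set is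
itself null. -/
theorem volume_removeNth_preimage_eq_zero {n : ℕ} (i : Fin (n + 1)) {s : Set (Fin n → ℝ)}
    (hs : volume s = 0) :
    volume {x : Fin (n + 1) → ℝ | (fun j => x (i.succAbove j)) ∈ s} = 0 := by
  have hmp := volume_preserving_piFinSuccAbove (fun _ : Fin (n + 1) => ℝ) i
  have hprod : volume ((Set.univ : Set ℝ) ×ˢ s) = 0 := by
    rw [Measure.volume_eq_prod, Measure.prod_prod, hs, mul_zero]
  have hpre := hmp.quasiMeasurePreserving.preimage_null hprod
  refine measure_mono_null (fun x hx => ?_) hpre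
  exact ⟨Set.mem_univ _, hx⟩

/-- Forgetting a coordinate maps `μH[n]`-null subsets of `ℝ^(n+1)` to Lebesgue null sets. -/
theorem volume_removeNth_image_eq_zero {n : ℕ} (i : Fin (n + 1))
    {s : Set (EuclideanSpace ℝ (Fin (n + 1)))} (hs : μH[(n : ℝ)] s = 0) :
    volume ((fun x : EuclideanSpace ℝ (Fin (n + 1)) => fun j => x (i.succAbove j)) '' s) = 0 := by
  have hlip : LipschitzWith 1
      (fun x : EuclideanSpace ℝ (Fin (n + 1)) => fun j => x (i.succAbove j)) := by
    refine LipschitzWith.of_dist_le_mul fun x y => ?_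
    rw [NNReal.coe_one, one_mul]
    refine (dist_pi_le_iff dist_nonneg).2 fun j => ?_
    rw [dist_eq_norm, dist_eq_norm]
    exact PiLp.norm_apply_le (x - y) (i.succAbove j)
  have hle := hlip.hausdorffMeasure_image_le n.cast_nonneg s
  rw [hs, mul_zero] at hle
  have hvol : (μH[(n : ℝ)] : Measure (Fin n → ℝ)) = volume := by
    simpa using hausdorffMeasure_pi_real (ι := Fin n)
  rw [← hvol]
  exact le_antisymm hle zero_le

/-- The linear functional `x ↦ ∑ i, x i * a i`. -/
noncomputable def coordFunctional {ι : Type*} [Fintype ι] (a : ι → ℝ) : (ι → ℝ) →ₗ[ℝ] ℝ :=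
  ∑ i, a i • LinearMap.proj i

theorem coordFunctional_apply {ι : Type*} [Fintype ι] (a x : ι → ℝ) :
    coordFunctional a x = ∑ i, x i * a i := by
  simp [coordFunctional, mul_comm]

/-- A linear hyperplane is Lebesgue null. -/
theorem volume_hyperplane_eq_zero {ι : Type*} [Fintype ι] {a : ι → ℝ} {i : ι} (hi : a i ≠ 0) :
    volume {x : ι → ℝ | ∑ j, x j * a j = 0} = 0 := by
  classical
  have hker : LinearMap.ker (coordFunctional a) ≠ ⊤ := by
    intro h
    have hmem : (Pi.single i 1 : ι → ℝ) ∈ LinearMap.ker (coordFunctional a) := h ▸ trivial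
    rw [LinearMap.mem_ker, coordFunctional_apply] at hmem
    simp [Pi.single_apply, hi] at hmem
  convert Measure.addHaar_submodule volume _ hker using 2
  ext x
  simp [coordFunctional_apply]

/-- The cone over a `μH[n]`-null subset of an affine hyperplane in `ℝ^(n+1)` is Lebesgue null. -/
theorem volume_cone_eq_zero {n : ℕ} {a : Fin (n + 1) → ℝ} {i : Fin (n + 1)} (hi : a i ≠ 0)
    {c : ℝ} {s : Set (EuclideanSpace ℝ (Fin (n + 1)))} (hsub : ∀ γ ∈ s, ∑ j, γ j * a j = c)
    (hs : μH[(n : ℝ)] s = 0) :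
    volume {x : Fin (n + 1) → ℝ | ∃ t : ℝ, ∃ γ ∈ s, x = t • γ.ofLp} = 0 := by
  let F : (Fin (n + 1) → ℝ) → (Fin (n + 1) → ℝ) := fun x => x i •
    (x + ((c - ∑ j, x j * a j) / a i) • Pi.single i 1)
  have hF : Differentiable ℝ F := by
    fun_prop
  have hnull := addHaar_image_eq_zero_of_differentiableOn_of_addHaar_eq_zero volume
    hF.differentiableOn
    (volume_removeNth_preimage_eq_zero i (volume_removeNth_image_eq_zero i hs))
  refine measure_mono_null ?_ hnull
  rintro _ ⟨t, γ, hγ, rfl⟩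
  refine ⟨γ.ofLp + (t - γ i) • Pi.single i 1, ⟨γ, hγ, ?_⟩, ?_⟩
  · ext j
    simp [Fin.succAbove_ne]
  · have hsum : ∑ j, (γ.ofLp + (t - γ i) • Pi.single i 1 : Fin (n + 1) → ℝ) j * a j
        = c + (t - γ i) * a i := by
      simp [add_mul, Finset.sum_add_distrib, hsub γ hγ, Pi.single_apply]
    simp only [F]
    rw [hsum]
    have hcoef : (c - (c + (t - γ i) * a i)) / a i = -(t - γ i) := by
      field_simp
      ring
    rw [hcoef, neg_smul, add_neg_cancel_right]
    simp

/-- Let `Γ = {γ : γ·k = m}` (`k ∈ ℤ^d` nonzero, `m ∈ ℤ` nonzero) be an affine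
hyperplane in `ℝ^d`. If `A ⊆ Γ` has full `(d-1)`-dimensional Hausdorff measure
in `Γ`, then the cone `{t γ : t ≠ 0, γ ∈ A}` has full Lebesgue measure in `ℝ^d`. -/
theorem stmt3 (d : ℕ) (hd : 2 ≤ d) (k : Fin d → ℤ) (hk : k ≠ 0) (m : ℤ) (hm : m ≠ 0)
    (A : Set (EuclideanSpace ℝ (Fin d)))
    (hA : A ⊆ {γ : EuclideanSpace ℝ (Fin d) | ∑ i, γ i * (k i : ℝ) = (m : ℝ)})
    (hfull : μH[(d : ℝ) - 1]
      ({γ : EuclideanSpace ℝ (Fin d) | ∑ i, γ i * (k i : ℝ) = (m : ℝ)} \ A) = 0) :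
    volume {x : EuclideanSpace ℝ (Fin d) | ∃ t : ℝ, t ≠ 0 ∧ ∃ γ ∈ A, x = t • γ}ᶜ = 0 := by
  obtain ⟨n, rfl⟩ : ∃ n, d = n + 1 := ⟨d - 1, by omega⟩
  obtain ⟨i, hi⟩ := Function.ne_iff.1 hk
  have hi' : (k i : ℝ) ≠ 0 := by exact_mod_cast hi
  have hm' : (m : ℝ) ≠ 0 := by exact_mod_cast hm
  rw [Nat.cast_add_one, add_sub_cancel_right] at hfull
  have hnull := measure_union_null
    (volume_hyperplane_eq_zero (a := fun j => (k j : ℝ)) hi')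
    (volume_cone_eq_zero (a := fun j => (k j : ℝ)) hi' (fun γ hγ => hγ.1) hfull)
  have hpre := (EuclideanSpace.volume_preserving_symm_measurableEquiv_toLp
    (Fin (n + 1))).quasiMeasurePreserving.preimage_null hnull
  refine measure_mono_null (fun x hx => ?_) hpre
  by_cases hx0 : ∑ j, x j * (k j : ℝ) = 0
  · exact Or.inl hx0
  · have ht : (∑ j, x j * (k j : ℝ)) / m ≠ 0 := div_ne_zero hx0 hm'
    set t := (∑ j, x j * (k j : ℝ)) / m with htdef
    have hxt : x = t • t⁻¹ • x := (smul_inv_smul₀ ht x).symm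
    refine Or.inr ⟨t, t⁻¹ • x, ⟨?_, fun hA' => hx ⟨t, ht, _, hA', hxt⟩⟩,
      congrArg WithLp.ofLp hxt⟩
    have hsum : ∑ j, (t⁻¹ • x) j * (k j : ℝ) = t⁻¹ * ∑ j, x j * (k j : ℝ) := by
      simp [Finset.mul_sum, mul_assoc]
    rw [Set.mem_ofPred_eq, hsum, htdef]
    field_simp
end

section
/- Let d ≥ 2, Ω ∈ ℝ^{d−1}, β = (β_ψ, β_η) ∈ ℝ^{d−1} × ℝ, let W : 𝕋^d → ℝ, v : 𝕋^d → ℝ, λ : 𝕋¹ → ℝ and ι : 𝕋¹ → ℝ be functions, with the coordinates of 𝕋^d written (ψ, η) ∈ 𝕋^{d−1} × 𝕋¹. Suppose that for all (ψ, η): v(ψ+Ω, η) + v(ψ−Ω, η) − 2v(ψ, η) + W((ψ,η) + β·v(ψ,η)) + λ(η) = 0. Define ṽ(ψ,η) = v((ψ,η) + ι(η)·β) + ι(η) and λ̃(η) = λ(η + ι(η)·β_η). Then for all (ψ,η): ṽ(ψ+Ω, η) + ṽ(ψ−Ω, η) − 2ṽ(ψ, η) + W((ψ,η) + β·ṽ(ψ,η))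 + λ̃(η) = 0. -/
open scoped BigOperators

/-- The symmetry of the invariance equation: if `(v, λ)` solves
`v(ψ+Ω,η) + v(ψ-Ω,η) - 2v(ψ,η) + W((ψ,η) + β v(ψ,η)) + λ(η) = 0`, then for any
`ι : 𝕋¹ → ℝ` so do `ṽ(ψ,η) = v((ψ,η) + ι(η)β) + ι(η)` and
`λ̃(η) = λ(η + ι(η)β_η)`. -/
theorem stmt9 (d : ℕ) (hd : 2 ≤ d) (Ω : Fin (d - 1) → ℝ)
    (β : (Fin (d - 1) → ℝ) × ℝ)
    (W : ((Fin (d - 1) → AddCircle (1 : ℝ)) × AddCircle (1 : ℝ)) → ℝ)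
    (v : ((Fin (d - 1) → AddCircle (1 : ℝ)) × AddCircle (1 : ℝ)) → ℝ)
    (lam : AddCircle (1 : ℝ) → ℝ) (ι : AddCircle (1 : ℝ) → ℝ)
    (heq : ∀ (ψ : Fin (d - 1) → AddCircle (1 : ℝ)) (η : AddCircle (1 : ℝ)),
      v (ψ + fun i => ((Ω i : ℝ) : AddCircle (1 : ℝ)), η) +
        v (ψ - fun i => ((Ω i : ℝ) : AddCircle (1 : ℝ)), η) - 2 * v (ψ, η) +
        W (ψ + fun i => ((v (ψ, η) * β.1 i : ℝ) : AddCircle (1 : ℝ)),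
           η + ((v (ψ, η) * β.2 : ℝ) : AddCircle (1 : ℝ))) + lam η = 0)
    (tv : ((Fin (d - 1) → AddCircle (1 : ℝ)) × AddCircle (1 : ℝ)) → ℝ)
    (htv : ∀ (ψ : Fin (d - 1) → AddCircle (1 : ℝ)) (η : AddCircle (1 : ℝ)),
      tv (ψ, η) = v (ψ + fun i => ((ι η * β.1 i : ℝ) : AddCircle (1 : ℝ)),
        η + ((ι η * β.2 : ℝ) : AddCircle (1 : ℝ))) + ι η)
    (tlam : AddCircle (1 : ℝ) → ℝ)
    (htlam : ∀ η : AddCircle (1 : ℝ),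
      tlam η = lam (η + ((ι η * β.2 : ℝ) : AddCircle (1 : ℝ)))) :
    ∀ (ψ : Fin (d - 1) → AddCircle (1 : ℝ)) (η : AddCircle (1 : ℝ)),
      tv (ψ + fun i => ((Ω i : ℝ) : AddCircle (1 : ℝ)), η) +
        tv (ψ - fun i => ((Ω i : ℝ) : AddCircle (1 : ℝ)), η) - 2 * tv (ψ, η) +
        W (ψ + fun i => ((tv (ψ, η) * β.1 i : ℝ) : AddCircle (1 : ℝ)),
           η + ((tv (ψ, η) * β.2 : ℝ) : AddCircle (1 : ℝ))) + tlam η = 0 := by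
  intro ψ η
  have h := heq (ψ + fun i => ((ι η * β.1 i : ℝ) : AddCircle (1 : ℝ)))
    (η + ((ι η * β.2 : ℝ) : AddCircle (1 : ℝ)))
  rw [add_right_comm ψ _ fun i => ((Ω i : ℝ) : AddCircle (1 : ℝ)), add_sub_right_comm ψ] at h
  have hψ : (ψ + fun i => ((tv (ψ, η) * β.1 i : ℝ) : AddCircle (1 : ℝ))) =
      (ψ + fun i => ((ι η * β.1 i : ℝ) : AddCircle (1 : ℝ))) +
        fun i => (((tv (ψ, η) - ι η) * β.1 i : ℝ) : AddCircle (1 : ℝ)) := by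
    ext i
    simp only [Pi.add_apply]
    rw [add_assoc, ← AddCircle.coe_add]
    congr 2
    ring
  have hη : η + ((tv (ψ, η) * β.2 : ℝ) : AddCircle (1 : ℝ)) =
      η + ((ι η * β.2 : ℝ) : AddCircle (1 : ℝ)) +
        (((tv (ψ, η) - ι η) * β.2 : ℝ) : AddCircle (1 : ℝ)) := by
    rw [add_assoc, ← AddCircle.coe_add]
    congr 2
    ring
  rw [hψ, hη]
  simp only [htv, htlam, add_sub_cancel_right]
  linarith
end
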